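/- arXiv:math/0602388 — 6 statements merged into one kernel-verified Lean document; each statement's English description precedes it below -/
import Mathlib

section
/- For all real numbers s > 0 and t > 0, one has min(s^{δ+1}, s^{g₀+1})·G(t)/(1+g₀) ≤ G(s·t) ≤ (1+g₀)·max(s^{δ+1}, s^{g₀+1})·G(t). -/
open Real

/-- If `a * f t ≤ t * f' t` for all `t > 0`, then `t ↦ f t * t ^ (-a)` is nondecreasing. -/
lemma monotoneOn_mul_rpow_neg {f f' : ℝ → ℝ} {a : ℝ}
    (hf : ∀ t > 0, HasDerivAt f (f' t) t) (ha : ∀ t > 0, a * f t ≤ t * f' t) :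
    MonotoneOn (fun t => f t * t ^ (-a)) (Set.Ioi 0) := by
  have hd : ∀ t > (0:ℝ), HasDerivAt (fun t => f t * t ^ (-a))
      (f' t * t ^ (-a) + f t * (-a * t ^ (-a - 1))) t := fun t ht =>
    (hf t ht).mul (Real.hasDerivAt_rpow_const (Or.inl ht.ne'))
  refine monotoneOn_of_hasDerivWithinAt_nonneg (convex_Ioi 0)
    (fun t ht => (hd t ht).continuousAt.continuousWithinAt)
    (fun t ht => (hd t (interior_subset ht)).hasDerivWithinAt) fun t ht => ?_
  have ht : 0 < t := interior_subset ht
  have hpow : t ^ (-a) = t * t ^ (-a - 1) := by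
    rw [Real.rpow_sub_one ht.ne']
    field_simp
  have := mul_nonneg (sub_nonneg.2 (ha t ht)) (Real.rpow_nonneg ht.le (-a - 1))
  rw [hpow]
  linarith

lemma rpow_mul_le_of_one_le {f f' : ℝ → ℝ} {a : ℝ}
    (hf : ∀ t > 0, HasDerivAt f (f' t) t) (ha : ∀ t > 0, a * f t ≤ t * f' t)
    {s x : ℝ} (hs : 1 ≤ s) (hx : 0 < x) : s ^ a * f x ≤ f (s * x) := by
  have hs0 : 0 < s := one_pos.trans_le hs
  have h : f x * x ^ (-a) ≤ f (s * x) * (s * x) ^ (-a) :=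
    monotoneOn_mul_rpow_neg hf ha hx (mul_pos hs0 hx) (le_mul_of_one_le_left hx.le hs)
  rw [Real.mul_rpow hs0.le hx.le, ← mul_assoc] at h
  have h := le_of_mul_le_mul_right h (Real.rpow_pos_of_pos hx _)
  rwa [Real.rpow_neg hs0.le, ← div_eq_mul_inv, le_div_iff₀ (Real.rpow_pos_of_pos hs0 _),
    mul_comm] at h

lemma le_rpow_mul_of_le_one {f f' : ℝ → ℝ} {a : ℝ}
    (hf : ∀ t > 0, HasDerivAt f (f' t) t) (ha : ∀ t > 0, a * f t ≤ t * f' t)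
    {s x : ℝ} (hs0 : 0 < s) (hs : s ≤ 1) (hx : 0 < x) : f (s * x) ≤ s ^ a * f x := by
  have h := rpow_mul_le_of_one_le hf ha ((one_le_inv₀ hs0).2 hs) (mul_pos hs0 hx)
  rwa [inv_mul_cancel_left₀ hs0.ne', Real.inv_rpow hs0.le,
    inv_mul_le_iff₀ (Real.rpow_pos_of_pos hs0 _)] at h

/-- Scaling bounds for a positive function whose logarithmic derivative `t * g' t / g t`
lies in `[a, b]`. -/
lemma min_rpow_mul_le_and_le_max_rpow_mul {g g' : ℝ → ℝ} {a b : ℝ}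
    (hgpos : ∀ t > 0, 0 < g t) (hg : ∀ t > 0, HasDerivAt g (g' t) t)
    (hab : ∀ t > 0, a ≤ t * g' t / g t ∧ t * g' t / g t ≤ b)
    {s x : ℝ} (hs : 0 < s) (hx : 0 < x) :
    min (s ^ a) (s ^ b) * g x ≤ g (s * x) ∧ g (s * x) ≤ max (s ^ a) (s ^ b) * g x := by
  have ha : ∀ t > 0, a * g t ≤ t * g' t := fun t ht =>
    (le_div_iff₀ (hgpos t ht)).1 (hab t ht).1
  have hb : ∀ t > 0, b * (-g) t ≤ t * (-g') t := fun t ht => by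
    have := (div_le_iff₀ (hgpos t ht)).1 (hab t ht).2
    simp only [Pi.neg_apply]
    linarith
  have hneg : ∀ t > 0, HasDerivAt (-g) ((-g') t) t := fun t ht => (hg t ht).neg
  have hgx := (hgpos x hx).le
  have hmin_a := mul_le_mul_of_nonneg_right (min_le_left (s ^ a) (s ^ b)) hgx
  have hmin_b := mul_le_mul_of_nonneg_right (min_le_right (s ^ a) (s ^ b)) hgx
  have hmax_a := mul_le_mul_of_nonneg_right (le_max_left (s ^ a) (s ^ b)) hgx
  have hmax_b := mul_le_mul_of_nonneg_right (le_max_right (s ^ a) (s ^ b)) hgx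
  rcases le_total 1 s with h | h
  · have hlower := rpow_mul_le_of_one_le hg ha h hx
    have hupper := rpow_mul_le_of_one_le hneg hb h hx
    simp only [Pi.neg_apply] at hupper
    constructor <;> linarith
  · have hupper := le_rpow_mul_of_le_one hg ha hs h hx
    have hlower := le_rpow_mul_of_le_one hneg hb hs h hx
    simp only [Pi.neg_apply] at hlower
    constructor <;> linarith

theorem G_scaling_property
    (δ g₀ : ℝ) (hδ : 0 < δ) (hδg₀ : δ ≤ g₀)
    (g g' : ℝ → ℝ)
    (hgc : ContinuousOn g (Set.Ici 0)) (hg0 : g 0 = 0)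
    (hgpos : ∀ t > 0, 0 < g t)
    (hgderiv : ∀ t > 0, HasDerivAt g (g' t) t)
    (hg'c : ContinuousOn g' (Set.Ioi 0))
    (hstruct : ∀ t > 0, δ ≤ t * g' t / g t ∧ t * g' t / g t ≤ g₀)
    (G : ℝ → ℝ) (hG : ∀ t, G t = ∫ s in (0:ℝ)..t, g s) :
    ∀ s > (0:ℝ), ∀ t > (0:ℝ),
      min (s ^ (δ + 1)) (s ^ (g₀ + 1)) * G t / (1 + g₀) ≤ G (s * t) ∧
      G (s * t) ≤ (1 + g₀) * max (s ^ (δ + 1)) (s ^ (g₀ + 1)) * G t := by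
  intro s hs t ht
  have hbound : ∀ x ∈ Set.Icc 0 t, min (s ^ δ) (s ^ g₀) * g x ≤ g (s * x) ∧
      g (s * x) ≤ max (s ^ δ) (s ^ g₀) * g x := fun x hx => by
    rcases hx.1.eq_or_lt with rfl | hx0
    · simp [hg0]
    · exact min_rpow_mul_le_and_le_max_rpow_mul hgpos hgderiv hstruct hs hx0
  have hint : IntervalIntegrable g MeasureTheory.volume 0 t :=
    (hgc.mono fun x hx => (Set.uIcc_of_le ht.le ▸ hx).1).intervalIntegrable
  have hint_scaled : IntervalIntegrable (fun x => g (s * x)) MeasureTheory.volume 0 t := by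
    refine ContinuousOn.intervalIntegrable (hgc.comp (by fun_prop) fun x hx => ?_)
    exact mul_nonneg hs.le (Set.uIcc_of_le ht.le ▸ hx).1
  have hGs : G (s * t) = s * ∫ x in (0:ℝ)..t, g (s * x) := by
    rw [hG, intervalIntegral.mul_integral_comp_mul_left, mul_zero]
  have hlower := intervalIntegral.integral_mono_on ht.le (hint.const_mul _) hint_scaled
    fun x hx => (hbound x hx).1
  have hupper := intervalIntegral.integral_mono_on ht.le hint_scaled (hint.const_mul _)
    fun x hx => (hbound x hx).2
  rw [intervalIntegral.integral_const_mul, ← hG] at hlower hupper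
  have hGt : 0 ≤ G t := by
    rw [hG]
    refine intervalIntegral.integral_nonneg ht.le fun x hx => ?_
    rcases hx.1.eq_or_lt with rfl | hx0
    · exact hg0.ge
    · exact (hgpos x hx0).le
  have hg₀ : 1 ≤ 1 + g₀ := by linarith
  rw [Real.rpow_add_one hs.ne', Real.rpow_add_one hs.ne', ← min_mul_of_nonneg _ _ hs.le,
    ← max_mul_of_nonneg _ _ hs.le, hGs]
  have hmin : 0 ≤ min (s ^ δ) (s ^ g₀) * s * G t := by positivity
  have hmax : 0 ≤ max (s ^ δ) (s ^ g₀) * s * G t := by positivity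
  constructor
  · refine (div_le_self hmin hg₀).trans ?_
    linarith [mul_le_mul_of_nonneg_left hlower hs.le]
  · rw [mul_assoc (1 + g₀)]
    refine le_trans ?_ (le_mul_of_one_le_left hmax hg₀)
    linarith [mul_le_mul_of_nonneg_left hupper hs.le]
end

section
/- For all real numbers s > 0 and t > 0, one has min(s^{1/δ}, s^{1/g₀})·g⁻¹(t) ≤ g⁻¹(s·t) ≤ max(s^{1/δ}, s^{1/g₀})·g⁻¹(t). -/
open Real

/-- The derivative of `log g - c log` is the logarithmic derivative of `g` minus `c / t`. -/
lemma hasDerivAt_log_comp_sub_mul_log {g : ℝ → ℝ} {d t : ℝ} (c : ℝ) (ht : 0 < t) (hg : 0 < g t)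
    (hd : HasDerivAt g d t) :
    HasDerivAt (fun x => log (g x) - c * log x) ((t * d / g t - c) / t) t := by
  have heq : (t * d / g t - c) / t = d / g t - c * t⁻¹ := by
    have := hg.ne'
    field_simp
  rw [heq]
  exact (hd.log hg.ne').sub ((hasDerivAt_log ht.ne').const_mul c)

/-- A lower bound `c` on the elasticity of `g` bounds increments of `log g` from below. -/
lemma mul_log_sub_le_of_le_elasticity {g g' : ℝ → ℝ} {c a b : ℝ}
    (hgpos : ∀ t > 0, 0 < g t) (hgderiv : ∀ t > 0, HasDerivAt g (g' t) t)
    (hc : ∀ t > 0, c ≤ t * g' t / g t) (ha : 0 < a) (hab : a ≤ b) :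
    c * (log b - log a) ≤ log (g b) - log (g a) := by
  have hderiv := fun t (ht : 0 < t) =>
    hasDerivAt_log_comp_sub_mul_log c ht (hgpos t ht) (hgderiv t ht)
  have hmono : MonotoneOn (fun x => log (g x) - c * log x) (Set.Ioi 0) := by
    refine monotoneOn_of_hasDerivWithinAt_nonneg (convex_Ioi 0)
      (fun t ht => (hderiv t ht).continuousAt.continuousWithinAt)
      (fun t ht => (hderiv t (interior_subset ht)).hasDerivWithinAt) fun t ht => ?_
    have ht' : 0 < t := interior_subset ht
    exact div_nonneg (sub_nonneg.2 (hc t ht')) ht'.le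
  have := hmono ha (ha.trans_le hab) hab
  dsimp only at this
  linarith

/-- An upper bound `c` on the elasticity of `g` bounds increments of `log g` from above. -/
lemma log_sub_le_mul_of_elasticity_le {g g' : ℝ → ℝ} {c a b : ℝ}
    (hgpos : ∀ t > 0, 0 < g t) (hgderiv : ∀ t > 0, HasDerivAt g (g' t) t)
    (hc : ∀ t > 0, t * g' t / g t ≤ c) (ha : 0 < a) (hab : a ≤ b) :
    log (g b) - log (g a) ≤ c * (log b - log a) := by
  have hderiv := fun t (ht : 0 < t) =>
    hasDerivAt_log_comp_sub_mul_log c ht (hgpos t ht) (hgderiv t ht)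
  have hanti : AntitoneOn (fun x => log (g x) - c * log x) (Set.Ioi 0) := by
    refine antitoneOn_of_hasDerivWithinAt_nonpos (convex_Ioi 0)
      (fun t ht => (hderiv t ht).continuousAt.continuousWithinAt)
      (fun t ht => (hderiv t (interior_subset ht)).hasDerivWithinAt) fun t ht => ?_
    have ht' : 0 < t := interior_subset ht
    exact div_nonpos_of_nonpos_of_nonneg (sub_nonpos.2 (hc t ht')) ht'.le
  have := hanti ha (ha.trans_le hab) hab
  dsimp only at this
  linarith

lemma rpow_one_div_mul_le_iff {s c a b : ℝ} (hs : 0 < s) (hc : 0 < c) (ha : 0 < a) (hb : 0 < b) :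
    s ^ (1 / c) * a ≤ b ↔ log s ≤ c * (log b - log a) := by
  rw [← log_le_log_iff (by positivity) hb, log_mul (by positivity) ha.ne', log_rpow hs,
    ← le_sub_iff_add_le, one_div_mul_eq_div, div_le_iff₀' hc]

lemma le_rpow_one_div_mul_iff {s c a b : ℝ} (hs : 0 < s) (hc : 0 < c) (ha : 0 < a) (hb : 0 < b) :
    b ≤ s ^ (1 / c) * a ↔ c * (log b - log a) ≤ log s := by
  rw [← log_le_log_iff hb (by positivity), log_mul (by positivity) ha.ne', log_rpow hs,
    ← sub_le_iff_le_add, one_div_mul_eq_div, le_div_iff₀' hc]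

theorem ginv_scaling_property
    (δ g₀ : ℝ) (hδ : 0 < δ) (hδg₀ : δ ≤ g₀)
    (g g' : ℝ → ℝ)
    (hgc : ContinuousOn g (Set.Ici 0)) (hg0 : g 0 = 0)
    (hgpos : ∀ t > 0, 0 < g t)
    (hgderiv : ∀ t > 0, HasDerivAt g (g' t) t)
    (hg'c : ContinuousOn g' (Set.Ioi 0))
    (hstruct : ∀ t > 0, δ ≤ t * g' t / g t ∧ t * g' t / g t ≤ g₀)
    (G : ℝ → ℝ) (hG : ∀ t, G t = ∫ s in (0:ℝ)..t, g s)
    (ginv : ℝ → ℝ)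
    (hginv_pos : ∀ t > 0, 0 < ginv t)
    (hginv_right : ∀ t > 0, g (ginv t) = t)
    (hginv_left : ∀ t > 0, ginv (g t) = t)
    (Gtil : ℝ → ℝ) (hGtil : ∀ t, Gtil t = ∫ s in (0:ℝ)..t, ginv s) :
    ∀ s > (0:ℝ), ∀ t > (0:ℝ),
      min (s ^ (1 / δ)) (s ^ (1 / g₀)) * ginv t ≤ ginv (s * t) ∧
      ginv (s * t) ≤ max (s ^ (1 / δ)) (s ^ (1 / g₀)) * ginv t := by
  intro s hs t ht
  have hst : 0 < s * t := mul_pos hs ht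
  have hg₀ : 0 < g₀ := hδ.trans_le hδg₀
  have ha := hginv_pos t ht
  have hb := hginv_pos (s * t) hst
  have hlog : log (g (ginv (s * t))) - log (g (ginv t)) = log s := by
    rw [hginv_right t ht, hginv_right _ hst, log_mul hs.ne' ht.ne', add_sub_cancel_right]
  rcases le_total (ginv t) (ginv (s * t)) with hab | hba
  · have hlow := mul_log_sub_le_of_le_elasticity hgpos hgderiv (fun t ht => (hstruct t ht).1) ha hab
    have hupp := log_sub_le_mul_of_elasticity_le hgpos hgderiv (fun t ht => (hstruct t ht).2) ha hab
    rw [hlog] at hlow hupp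
    exact ⟨(mul_le_mul_of_nonneg_right (min_le_right _ _) ha.le).trans
        ((rpow_one_div_mul_le_iff hs hg₀ ha hb).2 hupp),
      ((le_rpow_one_div_mul_iff hs hδ ha hb).2 hlow).trans
        (mul_le_mul_of_nonneg_right (le_max_left _ _) ha.le)⟩
  · have hlow := mul_log_sub_le_of_le_elasticity hgpos hgderiv (fun t ht => (hstruct t ht).1) hb hba
    have hupp := log_sub_le_mul_of_elasticity_le hgpos hgderiv (fun t ht => (hstruct t ht).2) hb hba
    exact ⟨(mul_le_mul_of_nonneg_right (min_le_left _ _) ha.le).trans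
        ((rpow_one_div_mul_le_iff hs hδ ha hb).2 (by linarith)),
      ((le_rpow_one_div_mul_iff hs hg₀ ha hb).2 (by linarith)).trans
        (mul_le_mul_of_nonneg_right (le_max_right _ _) ha.le)⟩
end

section
/- For all t > 0, one has δ·t·g⁻¹(t)/(1+δ) ≤ G̃(t) ≤ t·g⁻¹(t). -/
open Real

/-- If `g` has logarithmic derivative at least `δ / t`, then `g(t) t ^ (-δ)` is nondecreasing. -/
theorem monotoneOn_mul_rpow_neg_s6 {δ : ℝ} {g g' : ℝ → ℝ}
    (hgpos : ∀ t > 0, 0 < g t) (hgderiv : ∀ t > 0, HasDerivAt g (g' t) t)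
    (hstruct : ∀ t > 0, δ ≤ t * g' t / g t) :
    MonotoneOn (fun t => g t * t ^ (-δ)) (Set.Ioi 0) := by
  have hderiv : ∀ t > 0, HasDerivAt (fun t => g t * t ^ (-δ))
      (g' t * t ^ (-δ) + g t * (-δ * t ^ (-δ - 1))) t := fun t ht =>
    (hgderiv t ht).mul (Real.hasDerivAt_rpow_const (Or.inl ht.ne'))
  apply monotoneOn_of_deriv_nonneg (convex_Ioi 0)
  · exact fun t ht => (hderiv t ht).continuousAt.continuousWithinAt
  · rw [interior_Ioi]
    exact fun t ht => (hderiv t ht).differentiableAt.differentiableWithinAt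
  · rw [interior_Ioi]
    intro t ht
    have ht : 0 < t := ht
    rw [(hderiv t ht).deriv, Real.rpow_sub_one ht.ne']
    have hbound := (le_div_iff₀ (hgpos t ht)).1 (hstruct t ht)
    have hpow : 0 < t ^ (-δ) := Real.rpow_pos_of_pos ht _
    have heq : g' t * t ^ (-δ) + g t * (-δ * (t ^ (-δ) / t)) =
        (t * g' t - δ * g t) * (t ^ (-δ) / t) := by
      field_simp
      ring
    rw [heq]
    exact mul_nonneg (by linarith) (by positivity)

/-- If `s a ^ (-δ) ≤ t b ^ (-δ)`, then `(s / t) ^ δ⁻¹ b ≤ a`. -/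
theorem rpow_inv_mul_le_of_mul_rpow_neg_le {δ a b s t : ℝ} (hδ : 0 < δ) (ha : 0 < a) (hb : 0 < b)
    (hs : 0 < s) (ht : 0 < t) (h : s * a ^ (-δ) ≤ t * b ^ (-δ)) :
    (s / t) ^ δ⁻¹ * b ≤ a := by
  rw [Real.rpow_neg ha.le, Real.rpow_neg hb.le, ← div_eq_mul_inv, ← div_eq_mul_inv,
    div_le_div_iff₀ (by positivity) (by positivity)] at h
  rw [← Real.rpow_le_rpow_iff (by positivity) ha.le hδ,
    Real.mul_rpow (by positivity) hb.le, Real.rpow_inv_rpow (by positivity) hδ.ne',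
    div_mul_eq_mul_div, div_le_iff₀ ht]
  linarith

/-- A positive function that is nondecreasing on `(0, ∞)` is integrable on `[0, t]`. -/
theorem intervalIntegrable_of_monotoneOn_Ioi {f : ℝ → ℝ} (hpos : ∀ s > 0, 0 < f s)
    (hmono : MonotoneOn f (Set.Ioi 0)) {t : ℝ} (ht : 0 < t) :
    IntervalIntegrable f MeasureTheory.volume 0 t := by
  have hind : Monotone ((Set.Ioi 0).indicator f) := by
    intro a b hab
    by_cases ha : 0 < a
    · have hb : 0 < b := ha.trans_le hab
      simpa [Set.indicator, ha, hb] using hmono ha hb hab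
    · rw [Set.indicator_of_notMem (show a ∉ Set.Ioi 0 from ha)]
      exact Set.indicator_nonneg (fun x hx => (hpos x hx).le) b
  refine (hind.intervalIntegrable (a := 0) (b := t)).congr ?_
  intro s hs
  rw [Set.uIoc_of_le ht.le] at hs
  exact Set.indicator_of_mem (show s ∈ Set.Ioi 0 from hs.1) f

/-- The integral of `(s / t) ^ δ⁻¹` over `[0, t]`. -/
theorem integral_div_rpow_inv {δ t : ℝ} (hδ : 0 < δ) (ht : 0 < t) :
    ∫ s in (0 : ℝ)..t, (s / t) ^ δ⁻¹ = δ * t / (1 + δ) := by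
  have hexp : δ⁻¹ + 1 ≠ 0 := by positivity
  rw [intervalIntegral.integral_comp_div (fun x => x ^ δ⁻¹) ht.ne', zero_div, div_self ht.ne',
    integral_rpow (Or.inl (by linarith [inv_pos.2 hδ])), Real.one_rpow, Real.zero_rpow hexp]
  simp only [smul_eq_mul]
  field_simp
  ring

theorem Gtil_between_bounds
    (δ g₀ : ℝ) (hδ : 0 < δ) (hδg₀ : δ ≤ g₀)
    (g g' : ℝ → ℝ)
    (hgc : ContinuousOn g (Set.Ici 0)) (hg0 : g 0 = 0)
    (hgpos : ∀ t > 0, 0 < g t)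
    (hgderiv : ∀ t > 0, HasDerivAt g (g' t) t)
    (hg'c : ContinuousOn g' (Set.Ioi 0))
    (hstruct : ∀ t > 0, δ ≤ t * g' t / g t ∧ t * g' t / g t ≤ g₀)
    (G : ℝ → ℝ) (hG : ∀ t, G t = ∫ s in (0:ℝ)..t, g s)
    (ginv : ℝ → ℝ)
    (hginv_pos : ∀ t > 0, 0 < ginv t)
    (hginv_right : ∀ t > 0, g (ginv t) = t)
    (hginv_left : ∀ t > 0, ginv (g t) = t)
    (Gtil : ℝ → ℝ) (hGtil : ∀ t, Gtil t = ∫ s in (0:ℝ)..t, ginv s) :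
    ∀ t > (0:ℝ), δ * t * ginv t / (1 + δ) ≤ Gtil t ∧ Gtil t ≤ t * ginv t := by
  intro t ht
  have hgmono : StrictMonoOn g (Set.Ici 0) := by
    apply strictMonoOn_of_deriv_pos (convex_Ici 0) hgc
    rw [interior_Ici]
    intro x hx
    have hx : 0 < x := hx
    rw [(hgderiv x hx).deriv]
    have hbound := (le_div_iff₀ (hgpos x hx)).1 (hstruct x hx).1
    exact pos_of_mul_pos_right ((mul_pos hδ (hgpos x hx)).trans_le hbound) hx.le
  have hmono : MonotoneOn ginv (Set.Ioi 0) := by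
    intro a ha b hb hab
    rwa [← hgmono.le_iff_le (hginv_pos a ha).le (hginv_pos b hb).le, hginv_right a ha,
      hginv_right b hb]
  have hint := intervalIntegrable_of_monotoneOn_Ioi hginv_pos hmono ht
  rw [hGtil]
  constructor
  · have hlower : ∀ s ∈ Set.Ioo 0 t, (s / t) ^ δ⁻¹ * ginv t ≤ ginv s := by
      intro s hs
      have hquot := monotoneOn_mul_rpow_neg_s6 hgpos hgderiv (fun x hx => (hstruct x hx).1)
        (hginv_pos s hs.1) (hginv_pos t ht) (hmono hs.1 ht hs.2.le)
      simp only [hginv_right s hs.1, hginv_right t ht] at hquot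
      exact rpow_inv_mul_le_of_mul_rpow_neg_le hδ (hginv_pos s hs.1) (hginv_pos t ht) hs.1 ht hquot
    have hcont : Continuous fun s : ℝ => (s / t) ^ δ⁻¹ * ginv t :=
      ((continuous_id.div_const t).rpow_const fun _ => Or.inr (inv_pos.2 hδ).le).mul_const _
    calc δ * t * ginv t / (1 + δ) = ∫ s in (0 : ℝ)..t, (s / t) ^ δ⁻¹ * ginv t := by
          rw [intervalIntegral.integral_mul_const, integral_div_rpow_inv hδ ht]
          ring
      _ ≤ ∫ s in (0 : ℝ)..t, ginv s :=
          intervalIntegral.integral_mono_on_of_le_Ioo ht.le (hcont.intervalIntegrable _ _) hint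
            hlower
  · calc ∫ s in (0 : ℝ)..t, ginv s ≤ ∫ _ in (0 : ℝ)..t, ginv t :=
          intervalIntegral.integral_mono_on_of_le_Ioo ht.le hint intervalIntegrable_const
            fun s hs => hmono hs.1 ht hs.2.le
      _ = t * ginv t := by simp
end

section
/- For all real numbers s > 0 and t > 0, one has (δ/(1+δ))·min(s^{1+1/δ}, s^{1+1/g₀})·G̃(t) ≤ G̃(s·t) ≤ ((1+δ)/δ)·max(s^{1+1/δ}, s^{1+1/g₀})·G̃(t). -/
open Real

/-- Integrated form of `δ ≤ t g'(t) / g(t) ≤ g₀`, in logarithmic coordinates. -/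
theorem log_sub_log_bounds_of_log_deriv_bounds {δ g₀ : ℝ} {g g' : ℝ → ℝ}
    (hgpos : ∀ t > 0, 0 < g t) (hgderiv : ∀ t > 0, HasDerivAt g (g' t) t)
    (hstruct : ∀ t > 0, δ ≤ t * g' t / g t ∧ t * g' t / g t ≤ g₀)
    {x y : ℝ} (hx : 0 < x) (hxy : x ≤ y) :
    δ * (log y - log x) ≤ log (g y) - log (g x) ∧
      log (g y) - log (g x) ≤ g₀ * (log y - log x) := by
  have hderiv (c : ℝ) (t : ℝ) (ht : 0 < t) :
      HasDerivAt (fun t => log (g t) - c * log t) (g' t / g t - c * t⁻¹) t :=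
    ((hgderiv t ht).log (hgpos t ht).ne').sub ((hasDerivAt_log ht.ne').const_mul c)
  have hcont (c : ℝ) : ContinuousOn (fun t => log (g t) - c * log t) (Set.Ioi 0) :=
    fun t ht => (hderiv c t ht).continuousAt.continuousWithinAt
  have hfactor (c t : ℝ) (ht : 0 < t) :
      g' t / g t - c * t⁻¹ = (t * g' t / g t - c) * t⁻¹ := by
    field_simp
  have hmono : MonotoneOn (fun t => log (g t) - δ * log t) (Set.Ioi 0) := by
    refine monotoneOn_of_hasDerivWithinAt_nonneg (convex_Ioi 0) (hcont δ)
      (f' := fun t => g' t / g t - δ * t⁻¹) ?_ ?_ <;> rw [interior_Ioi] <;> intro t ht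
    · exact (hderiv δ t ht).hasDerivWithinAt
    · have ht : 0 < t := ht
      simp only [hfactor δ t ht]
      exact mul_nonneg (sub_nonneg.2 (hstruct t ht).1) (inv_nonneg.2 ht.le)
  have hanti : AntitoneOn (fun t => log (g t) - g₀ * log t) (Set.Ioi 0) := by
    refine antitoneOn_of_hasDerivWithinAt_nonpos (convex_Ioi 0) (hcont g₀)
      (f' := fun t => g' t / g t - g₀ * t⁻¹) ?_ ?_ <;> rw [interior_Ioi] <;> intro t ht
    · exact (hderiv g₀ t ht).hasDerivWithinAt
    · have ht : 0 < t := ht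
      simp only [hfactor g₀ t ht]
      exact mul_nonpos_of_nonpos_of_nonneg (sub_nonpos.2 (hstruct t ht).2) (inv_nonneg.2 ht.le)
  have h₁ := hmono (Set.mem_Ioi.2 hx) (Set.mem_Ioi.2 (hx.trans_le hxy)) hxy
  have h₂ := hanti (Set.mem_Ioi.2 hx) (Set.mem_Ioi.2 (hx.trans_le hxy)) hxy
  simp only at h₁ h₂
  constructor <;> linarith

/-- A positive right inverse of a function growing at least like a positive power is increasing. -/
theorem monotoneOn_rightInverse_of_log_sub_log_bound {δ : ℝ} (hδ : 0 < δ) {g ginv : ℝ → ℝ}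
    (hlog : ∀ x y, 0 < x → x ≤ y → δ * (log y - log x) ≤ log (g y) - log (g x))
    (hpos : ∀ t > 0, 0 < ginv t) (hright : ∀ t > 0, g (ginv t) = t) :
    MonotoneOn ginv (Set.Ioi 0) := by
  intro a ha b hb hab
  have ha : 0 < a := ha
  have hb : 0 < b := hb
  by_contra! hlt
  have h := hlog _ _ (hpos b hb) hlt.le
  rw [hright a ha, hright b hb] at h
  have h₁ := log_lt_log (hpos b hb) hlt
  have h₂ := log_le_log ha hab
  nlinarith

theorem rpow_mul_bounds_rightInverse {δ g₀ : ℝ} (hδ : 0 < δ) (hg₀ : 0 < g₀) {g ginv : ℝ → ℝ}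
    (hlog : ∀ x y, 0 < x → x ≤ y → δ * (log y - log x) ≤ log (g y) - log (g x) ∧
      log (g y) - log (g x) ≤ g₀ * (log y - log x))
    (hpos : ∀ t > 0, 0 < ginv t) (hright : ∀ t > 0, g (ginv t) = t)
    {s a : ℝ} (hs : 1 ≤ s) (ha : 0 < a) :
    s ^ (1 / g₀) * ginv a ≤ ginv (s * a) ∧ ginv (s * a) ≤ s ^ (1 / δ) * ginv a := by
  have hs0 : 0 < s := one_pos.trans_le hs
  have hsa : 0 < s * a := mul_pos hs0 ha
  have hmono := monotoneOn_rightInverse_of_log_sub_log_bound hδ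
    (fun x y hx hxy => (hlog x y hx hxy).1) hpos hright
  have h := hlog _ _ (hpos a ha) (hmono (Set.mem_Ioi.2 ha) (Set.mem_Ioi.2 hsa)
    (le_mul_of_one_le_left ha.le hs))
  rw [hright a ha, hright _ hsa, log_mul hs0.ne' ha.ne', add_sub_cancel_right] at h
  have hp (c : ℝ) : 0 < s ^ c := rpow_pos_of_pos hs0 c
  have hl (c : ℝ) : log (s ^ (1 / c) * ginv a) = log s / c + log (ginv a) := by
    rw [log_mul (hp _).ne' (hpos a ha).ne', log_rpow hs0]
    ring
  constructor
  · rw [← log_le_log_iff (mul_pos (hp _) (hpos a ha)) (hpos _ hsa), hl, ← le_sub_iff_add_le,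
      div_le_iff₀' hg₀]
    exact h.2
  · rw [← log_le_log_iff (hpos _ hsa) (mul_pos (hp _) (hpos a ha)), hl, ← sub_le_iff_le_add,
      le_div_iff₀' hδ]
    exact h.1

theorem min_max_rpow_mul_bounds_of_one_le {p q : ℝ} {h : ℝ → ℝ} (hpos : ∀ t > 0, 0 < h t)
    (hscale : ∀ s a, 1 ≤ s → 0 < a → s ^ q * h a ≤ h (s * a) ∧ h (s * a) ≤ s ^ p * h a)
    {s a : ℝ} (hs : 0 < s) (ha : 0 < a) :
    min (s ^ p) (s ^ q) * h a ≤ h (s * a) ∧ h (s * a) ≤ max (s ^ p) (s ^ q) * h a := by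
  have hle := mul_le_mul_of_nonneg_right (min_le_left (s ^ p) (s ^ q)) (hpos a ha).le
  have hle' := mul_le_mul_of_nonneg_right (min_le_right (s ^ p) (s ^ q)) (hpos a ha).le
  have hge := mul_le_mul_of_nonneg_right (le_max_left (s ^ p) (s ^ q)) (hpos a ha).le
  have hge' := mul_le_mul_of_nonneg_right (le_max_right (s ^ p) (s ^ q)) (hpos a ha).le
  rcases le_total 1 s with h1 | h1
  · obtain ⟨hl, hu⟩ := hscale s a h1 ha
    exact ⟨hle'.trans hl, hu.trans hge⟩
  · obtain ⟨hl, hu⟩ := hscale s⁻¹ (s * a) ((one_le_inv₀ hs).2 h1) (mul_pos hs ha)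
    rw [inv_mul_cancel_left₀ hs.ne', inv_rpow hs.le] at hl hu
    exact ⟨hle.trans ((le_inv_mul_iff₀ (rpow_pos_of_pos hs p)).1 hu),
      ((inv_mul_le_iff₀ (rpow_pos_of_pos hs q)).1 hl).trans hge'⟩

theorem intervalIntegrable_zero_of_monotoneOn_Ioi {h : ℝ → ℝ} (hpos : ∀ t > 0, 0 < h t)
    (hmono : MonotoneOn h (Set.Ioi 0)) {t : ℝ} (ht : 0 < t) :
    IntervalIntegrable h MeasureTheory.volume 0 t := by
  have hm : Monotone (fun u => if 0 < u then h u else 0) := by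
    intro a b hab
    by_cases ha : 0 < a
    · simpa [ha, ha.trans_le hab] using hmono ha (ha.trans_le hab) hab
    · by_cases hb : 0 < b
      · simpa [ha, hb] using (hpos b hb).le
      · simp [ha, hb]
  refine (hm.intervalIntegrable (a := 0) (b := t)).congr fun u hu => ?_
  rw [Set.uIoc_of_le ht.le] at hu
  simp [hu.1]

theorem min_max_rpow_mul_bounds_integral {p q : ℝ} {h : ℝ → ℝ} (hpos : ∀ t > 0, 0 < h t)
    (hmono : MonotoneOn h (Set.Ioi 0)) {s t : ℝ} (hs : 0 < s) (ht : 0 < t)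
    (hscale : ∀ u > 0, min (s ^ p) (s ^ q) * h u ≤ h (s * u) ∧
      h (s * u) ≤ max (s ^ p) (s ^ q) * h u) :
    min (s ^ (1 + p)) (s ^ (1 + q)) * (∫ u in (0:ℝ)..t, h u) ≤ ∫ u in (0:ℝ)..s * t, h u ∧
      ∫ u in (0:ℝ)..s * t, h u ≤
        max (s ^ (1 + p)) (s ^ (1 + q)) * (∫ u in (0:ℝ)..t, h u) := by
  have hint := intervalIntegrable_zero_of_monotoneOn_Ioi hpos hmono ht
  have hint' : IntervalIntegrable (fun u => h (s * u)) MeasureTheory.volume 0 t :=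
    intervalIntegrable_zero_of_monotoneOn_Ioi (fun u hu => hpos _ (mul_pos hs hu))
      (fun a ha b hb hab => hmono (Set.mem_Ioi.2 (mul_pos hs ha)) (Set.mem_Ioi.2 (mul_pos hs hb))
        (mul_le_mul_of_nonneg_left hab hs.le)) ht
  have hsub : ∫ u in (0:ℝ)..s * t, h u = s * ∫ u in (0:ℝ)..t, h (s * u) := by
    rw [intervalIntegral.mul_integral_comp_mul_left, mul_zero]
  rw [hsub, rpow_add hs, rpow_add hs, rpow_one, ← mul_min_of_nonneg _ _ hs.le,
    ← mul_max_of_nonneg _ _ hs.le, mul_assoc, mul_assoc]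
  constructor <;> refine mul_le_mul_of_nonneg_left ?_ hs.le <;>
    rw [← intervalIntegral.integral_const_mul]
  · exact intervalIntegral.integral_mono_on_of_le_Ioo ht.le (hint.const_mul _) hint'
      fun u hu => (hscale u hu.1).1
  · exact intervalIntegral.integral_mono_on_of_le_Ioo ht.le hint' (hint.const_mul _)
      fun u hu => (hscale u hu.1).2

theorem Gtil_scaling_property
    (δ g₀ : ℝ) (hδ : 0 < δ) (hδg₀ : δ ≤ g₀)
    (g g' : ℝ → ℝ)
    (hgc : ContinuousOn g (Set.Ici 0)) (hg0 : g 0 = 0)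
    (hgpos : ∀ t > 0, 0 < g t)
    (hgderiv : ∀ t > 0, HasDerivAt g (g' t) t)
    (hg'c : ContinuousOn g' (Set.Ioi 0))
    (hstruct : ∀ t > 0, δ ≤ t * g' t / g t ∧ t * g' t / g t ≤ g₀)
    (G : ℝ → ℝ) (hG : ∀ t, G t = ∫ s in (0:ℝ)..t, g s)
    (ginv : ℝ → ℝ)
    (hginv_pos : ∀ t > 0, 0 < ginv t)
    (hginv_right : ∀ t > 0, g (ginv t) = t)
    (hginv_left : ∀ t > 0, ginv (g t) = t)
    (Gtil : ℝ → ℝ) (hGtil : ∀ t, Gtil t = ∫ s in (0:ℝ)..t, ginv s) :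
    ∀ s > (0:ℝ), ∀ t > (0:ℝ),
      δ / (1 + δ) * min (s ^ (1 + 1 / δ)) (s ^ (1 + 1 / g₀)) * Gtil t ≤ Gtil (s * t) ∧
      Gtil (s * t) ≤ (1 + δ) / δ * max (s ^ (1 + 1 / δ)) (s ^ (1 + 1 / g₀)) * Gtil t := by
  intro s hs t ht
  have hlog := fun x y hx hxy =>
    log_sub_log_bounds_of_log_deriv_bounds hgpos hgderiv hstruct (x := x) (y := y) hx hxy
  have hmono := monotoneOn_rightInverse_of_log_sub_log_bound hδ
    (fun x y hx hxy => (hlog x y hx hxy).1) hginv_pos hginv_right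
  obtain ⟨hl, hu⟩ := min_max_rpow_mul_bounds_integral hginv_pos hmono hs ht fun u hu =>
    min_max_rpow_mul_bounds_of_one_le hginv_pos (fun _ _ h1 ha =>
      rpow_mul_bounds_rightInverse hδ (hδ.trans_le hδg₀) hlog hginv_pos hginv_right h1 ha) hs hu
  rw [← hGtil, ← hGtil] at hl hu
  have hnonneg : 0 ≤ Gtil t := by
    rw [hGtil]
    exact (intervalIntegral.intervalIntegral_pos_of_pos_on
      (intervalIntegrable_zero_of_monotoneOn_Ioi hginv_pos hmono ht)
      (fun u hu => hginv_pos u hu.1) ht).le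
  have hp (c : ℝ) : 0 ≤ s ^ c := rpow_nonneg hs.le c
  rw [mul_assoc, mul_assoc]
  constructor
  · refine (mul_le_of_le_one_left (mul_nonneg (le_min (hp _) (hp _)) hnonneg) ?_).trans hl
    exact (div_le_one (by linarith)).2 (by linarith)
  · refine hu.trans (le_mul_of_one_le_left (mul_nonneg (le_max_of_le_left (hp _)) hnonneg) ?_)
    exact (one_le_div hδ).2 (by linarith)
end

section
/- Let Ω ⊂ ℝᴺ be a nonempty bounded open set with diameter R, and let u : ℝᴺ → ℝ be a C¹ function whose support is a compact subset of Ω. Then ∫_Ω G(|u(x)|/R) dx ≤ ∫_Ω G(|∇u(x)|) dx. -/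
open Real MeasureTheory

/-- Jensen's inequality along a segment: if `u` vanishes at `x - R • e` for a unit vector `e`, then
`Φ (|u x| / R)` is at most the average of `Φ ‖∇ u‖` over the segment from `x - R • e` to `x`. -/
theorem map_abs_div_le_setAverage {E : Type*} [NormedAddCommGroup E] [NormedSpace ℝ E]
    {Φ : ℝ → ℝ} (hconv : ConvexOn ℝ Set.univ Φ) (hcont : Continuous Φ) (hmono : Monotone Φ)
    {u : E → ℝ} (hu : ContDiff ℝ 1 u) {R : ℝ} (hR : 0 < R) {x e : E} (he : ‖e‖ = 1)
    (hx : u (x - R • e) = 0) :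
    Φ (|u x| / R) ≤ ⨍ t in Set.Ioc 0 R, Φ ‖fderiv ℝ u (x - t • e)‖ := by
  have hfd : Continuous fun t : ℝ => fderiv ℝ u (x - t • e) :=
    (hu.continuous_fderiv one_ne_zero).comp (by fun_prop)
  have hnorm : Continuous fun t : ℝ => ‖fderiv ℝ u (x - t • e)‖ := hfd.norm
  have hderiv : ∀ t : ℝ, HasDerivAt (fun t : ℝ => u (x - t • e))
      (-(fderiv ℝ u (x - t • e) e)) t := by
    intro t
    have h1 : HasDerivAt (fun t : ℝ => x - t • e) (-e) t := by
      simpa using ((hasDerivAt_id t).smul_const e).const_sub x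
    rw [← map_neg]
    exact (hu.differentiable one_ne_zero (x - t • e)).hasFDerivAt.comp_hasDerivAt t h1
  have hFTC : ∫ t in (0:ℝ)..R, -(fderiv ℝ u (x - t • e) e) = -u x := by
    rw [intervalIntegral.integral_eq_sub_of_hasDerivAt (fun t _ => hderiv t)
      ((hfd.clm_apply continuous_const).neg.intervalIntegrable _ _)]
    simp [hx]
  have hbound : |u x| ≤ ∫ t in (0:ℝ)..R, ‖fderiv ℝ u (x - t • e)‖ := by
    rw [← abs_neg, ← hFTC, ← Real.norm_eq_abs]
    refine intervalIntegral.norm_integral_le_of_norm_le hR.le ?_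
      (hnorm.intervalIntegrable _ _)
    filter_upwards with t _
    simpa [he] using (fderiv ℝ u (x - t • e)).le_opNorm e
  have haverage : |u x| / R ≤ ⨍ t in Set.Ioc 0 R, ‖fderiv ℝ u (x - t • e)‖ := by
    rw [setAverage_eq, ← intervalIntegral.integral_of_le hR.le]
    simp only [measureReal_def, Real.volume_Ioc, sub_zero, ENNReal.toReal_ofReal hR.le,
      smul_eq_mul]
    rw [div_eq_inv_mul]
    gcongr
  refine (hmono haverage).trans ?_
  refine hconv.map_set_average_le hcont.continuousOn isClosed_univ ?_ ?_ (by simp) ?_ ?_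
  · simp [hR]
  · simp
  · exact hnorm.integrableOn_Ioc
  · exact (hcont.comp hnorm).integrableOn_Ioc

/-- The primitive of a continuous monotone function is convex. -/
theorem convexOn_integral_of_monotone {f : ℝ → ℝ} (hf : Continuous f) (hmono : Monotone f) :
    ConvexOn ℝ Set.univ fun t => ∫ s in (0:ℝ)..t, f s := by
  have hd : ∀ t, HasDerivAt (fun t => ∫ s in (0:ℝ)..t, f s) (f t) t := fun t =>
    hf.integral_hasStrictDerivAt 0 t |>.hasDerivAt
  refine Monotone.convexOn_univ_of_deriv (fun t => (hd t).differentiableAt) ?_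
  rwa [funext fun t => (hd t).deriv]

/-- The primitive of a continuous nonnegative function is monotone. -/
theorem monotone_integral_of_nonneg {f : ℝ → ℝ} (hf : Continuous f) (hnonneg : ∀ t, 0 ≤ f t) :
    Monotone fun t => ∫ s in (0:ℝ)..t, f s := by
  have hd : ∀ t, HasDerivAt (fun t => ∫ s in (0:ℝ)..t, f s) (f t) t := fun t =>
    hf.integral_hasStrictDerivAt 0 t |>.hasDerivAt
  exact monotone_of_deriv_nonneg (fun t => (hd t).differentiableAt)
    fun t => (hd t).deriv ▸ hnonneg t

/-- A translate of a point of an open set by a vector of length the diameter lies outside it. -/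
theorem sub_diam_smul_notMem {E : Type*} [NormedAddCommGroup E] [NormedSpace ℝ E] {Ω : Set E}
    (hΩo : IsOpen Ω) (hΩb : Bornology.IsBounded Ω) {x e : E} (hx : x ∈ Ω) (he : ‖e‖ = 1) :
    x - Metric.diam Ω • e ∉ Ω := by
  intro hy
  obtain ⟨ε, hε, hball⟩ := Metric.isOpen_iff.1 hΩo _ hy
  have hz : x - (Metric.diam Ω + ε / 2) • e ∈ Ω := by
    refine hball ?_
    rw [Metric.mem_ball, dist_eq_norm, add_smul, sub_sub_sub_cancel_left, sub_add_cancel_left,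
      norm_neg, norm_smul, he, mul_one, Real.norm_eq_abs, abs_of_pos (half_pos hε)]
    exact half_lt_self hε
  have h := Metric.dist_le_diam_of_mem hΩb hx hz
  rw [dist_eq_norm, sub_sub_cancel, norm_smul, he, mul_one, Real.norm_eq_abs,
    abs_of_nonneg (add_nonneg Metric.diam_nonneg (half_pos hε).le)] at h
  linarith

/-- Averaging a nonnegative, continuous, compactly supported function over translates does not
increase its integral. -/
theorem setIntegral_setAverage_translate_le {E : Type*} [NormedAddCommGroup E] [NormedSpace ℝ E]
    [FiniteDimensional ℝ E] [MeasurableSpace E] [BorelSpace E] (μ : Measure E)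
    [μ.IsAddHaarMeasure] {H : E → ℝ} (hH : Continuous H) (hHc : HasCompactSupport H)
    (hH0 : ∀ x, 0 ≤ H x) {Ω : Set E} (hΩb : Bornology.IsBounded Ω) {R : ℝ} (hR : 0 < R) (e : E) :
    IntegrableOn (fun x => ⨍ t in Set.Ioc 0 R, H (x - t • e)) Ω μ ∧
      ∫ x in Ω, (⨍ t in Set.Ioc 0 R, H (x - t • e)) ∂μ ≤ ∫ x, H x ∂μ := by
  have : IsFiniteMeasure (μ.restrict Ω) :=
    ⟨by simpa using hΩb.measure_lt_top⟩
  obtain ⟨C, hC⟩ := hHc.exists_bound_of_continuous hH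
  have hprod : Integrable (Function.uncurry fun (x : E) (t : ℝ) => H (x - t • e))
      ((μ.restrict Ω).prod (volume.restrict (Set.Ioc 0 R))) := by
    refine Integrable.of_bound (C := C) ?_ (ae_of_all _ fun p => hC _)
    exact (hH.comp (by fun_prop : Continuous fun p : E × ℝ => p.1 - p.2 • e)).aestronglyMeasurable
  have hHi : Integrable H μ := hH.integrable_of_hasCompactSupport hHc
  simp only [setAverage_eq, measureReal_def, Real.volume_Ioc, sub_zero,
    ENNReal.toReal_ofReal hR.le, smul_eq_mul]
  refine ⟨hprod.integral_prod_left.const_mul _, ?_⟩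
  rw [integral_const_mul, integral_integral_swap hprod, inv_mul_le_iff₀ hR]
  have hle : ∀ t : ℝ, ∫ x in Ω, H (x - t • e) ∂μ ≤ ∫ x, H x ∂μ := by
    intro t
    rw [← integral_sub_right_eq_self H (t • e)]
    exact setIntegral_le_integral (hHi.comp_sub_right _) (ae_of_all _ fun x => hH0 _)
  calc ∫ t in Set.Ioc 0 R, ∫ x in Ω, H (x - t • e) ∂μ
      ≤ ∫ _ in Set.Ioc 0 R, ∫ x, H x ∂μ :=
        integral_mono hprod.integral_prod_right (integrable_const _) hle
    _ = R * ∫ x, H x ∂μ := by simp [measureReal_def, hR.le]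

theorem poincare_type_inequality
    (δ g₀ : ℝ) (hδ : 0 < δ) (hδg₀ : δ ≤ g₀)
    (g g' : ℝ → ℝ)
    (hgc : ContinuousOn g (Set.Ici 0)) (hg0 : g 0 = 0)
    (hgpos : ∀ t > 0, 0 < g t)
    (hgderiv : ∀ t > 0, HasDerivAt g (g' t) t)
    (hg'c : ContinuousOn g' (Set.Ioi 0))
    (hstruct : ∀ t > 0, δ ≤ t * g' t / g t ∧ t * g' t / g t ≤ g₀)
    (G : ℝ → ℝ) (hG : ∀ t, G t = ∫ s in (0:ℝ)..t, g s)
    (N : ℕ) (hN : 1 ≤ N)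
    (Ω : Set (EuclideanSpace ℝ (Fin N)))
    (hΩne : Ω.Nonempty) (hΩo : IsOpen Ω) (hΩb : Bornology.IsBounded Ω)
    (u : EuclideanSpace ℝ (Fin N) → ℝ)
    (hu : ContDiff ℝ 1 u)
    (husupp : HasCompactSupport u) (husuppΩ : tsupport u ⊆ Ω) :
    ∫ x in Ω, G (|u x| / Metric.diam Ω) ≤ ∫ x in Ω, G ‖gradient u x‖ := by
  have hg_mono : MonotoneOn g (Set.Ici 0) := by
    refine monotoneOn_of_deriv_nonneg (convex_Ici 0) hgc ?_ ?_
    · rw [interior_Ici]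
      exact fun t ht => (hgderiv t ht).differentiableAt.differentiableWithinAt
    · rw [interior_Ici]
      intro t ht
      have ht0 : 0 < t := ht
      rw [(hgderiv t ht).deriv]
      have h := (div_pos_iff_of_pos_right (hgpos t ht)).1 (hδ.trans_le (hstruct t ht).1)
      exact (pos_of_mul_pos_right h ht0.le).le
  let f : ℝ → ℝ := fun t => g (max t 0)
  have hfc : Continuous f :=
    hgc.comp_continuous (by fun_prop) fun t => le_max_right t 0
  have hf_mono : Monotone f := fun s t hst =>
    hg_mono (le_max_right s 0) (le_max_right t 0) (max_le_max_right 0 hst)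
  have hf_nonneg : ∀ t, 0 ≤ f t := fun t => by
    simpa [hg0] using hg_mono Set.self_mem_Ici (le_max_right t 0) (le_max_right t 0)
  let Φ : ℝ → ℝ := fun t => ∫ s in (0:ℝ)..t, f s
  have hΦ0 : Φ 0 = 0 := intervalIntegral.integral_same
  have hΦ_mono : Monotone Φ := monotone_integral_of_nonneg hfc hf_nonneg
  have hΦ_conv : ConvexOn ℝ Set.univ Φ := convexOn_integral_of_monotone hfc hf_mono
  have hΦc : Continuous Φ :=
    intervalIntegral.continuous_primitive (fun a b => hfc.intervalIntegrable a b) 0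
  have hGΦ : ∀ t, 0 ≤ t → G t = Φ t := by
    intro t ht
    rw [hG]
    refine intervalIntegral.integral_congr fun s hs => ?_
    rw [Set.uIcc_of_le ht] at hs
    simp [f, hs.1]
  have : Nonempty (Fin N) := ⟨⟨0, hN⟩⟩
  obtain ⟨e, he⟩ := exists_norm_eq (EuclideanSpace ℝ (Fin N)) zero_le_one
  have hR : 0 < Metric.diam Ω := by
    refine Metric.diam_nonneg.lt_of_ne' fun h => ?_
    obtain ⟨x, hx⟩ := hΩne
    exact sub_diam_smul_notMem hΩo hΩb hx he (by simpa [h] using hx)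
  let H : EuclideanSpace ℝ (Fin N) → ℝ := fun x => Φ ‖fderiv ℝ u x‖
  have hHc : Continuous H := hΦc.comp (hu.continuous_fderiv one_ne_zero).norm
  have hHsupp : HasCompactSupport H :=
    (husupp.fderiv ℝ).comp_left (g := fun L => Φ ‖L‖) (by simpa using hΦ0)
  have hH0 : ∀ x, 0 ≤ H x := fun x => hΦ0 ▸ hΦ_mono (norm_nonneg _)
  obtain ⟨hint, hle⟩ :=
    setIntegral_setAverage_translate_le volume hHc hHsupp hH0 hΩb hR e
  have hLHS : IntegrableOn (fun x => Φ (|u x| / Metric.diam Ω)) Ω := by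
    refine (Continuous.integrable_of_hasCompactSupport
      (hΦc.comp (hu.continuous.abs.div_const _)) ?_).integrableOn
    exact husupp.comp_left (g := fun y => Φ (|y| / Metric.diam Ω)) (by simpa using hΦ0)
  calc ∫ x in Ω, G (|u x| / Metric.diam Ω)
      = ∫ x in Ω, Φ (|u x| / Metric.diam Ω) :=
        integral_congr_ae (ae_of_all _ fun x => hGΦ _ (by positivity))
    _ ≤ ∫ x in Ω, ⨍ t in Set.Ioc 0 (Metric.diam Ω), H (x - t • e) :=
        setIntegral_mono_on hLHS hint hΩo.measurableSet fun x hx =>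
          map_abs_div_le_setAverage hΦ_conv hΦc hΦ_mono hu hR he <|
            image_eq_zero_of_notMem_tsupport fun h =>
              sub_diam_smul_notMem hΩo hΩb hx he (husuppΩ h)
    _ ≤ ∫ x, H x := hle
    _ = ∫ x in Ω, H x := by
        refine (setIntegral_eq_integral_of_forall_compl_eq_zero fun x hx => ?_).symm
        have hfd : fderiv ℝ u x = 0 :=
          image_eq_zero_of_notMem_tsupport fun h => hx (husuppΩ (tsupport_fderiv_subset ℝ h))
        simp [H, hfd, hΦ0]
    _ = ∫ x in Ω, G ‖gradient u x‖ :=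
        integral_congr_ae (ae_of_all _ fun x => by
          simp [H, gradient, hGΦ _ (norm_nonneg _)])
end

section
/- (Explicit strict subsolution in an annulus) Let 0 < r₂ < r₁. There exists μ₀ > 0, depending only on δ, g₀, N and r₂, such that for every μ ≥ μ₀ and every ε > 0 the function w(x) = ε·e^{−μ|x|²} satisfies (ℒw)(x) := div( g(|∇w|)·∇w/|∇w| )(x) > 0 at every point x with r₂ < |x| < r₁ (note that ∇w(x) ≠ 0 there, so the vector field p ↦ g(|p|)·p/|p| composed with ∇w is C¹ near x and the pointwise divergence is defined). -/
open Real MeasureTheory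

/-- The function `w(x) = ε e^{-μ|x|²}`. -/
noncomputable def gaussBump (N : ℕ) (ε μ : ℝ) (x : EuclideanSpace ℝ (Fin N)) : ℝ :=
  ε * Real.exp (-μ * ‖x‖ ^ 2)

/-- The vector field `x ↦ g(|∇v(x)|) ∇v(x)/|∇v(x)|` (taken to be `0` where `∇v = 0`). -/
noncomputable def lField {N : ℕ} (g : ℝ → ℝ) (v : EuclideanSpace ℝ (Fin N) → ℝ)
    (x : EuclideanSpace ℝ (Fin N)) : EuclideanSpace ℝ (Fin N) :=
  (g ‖gradient v x‖ / ‖gradient v x‖) • gradient v x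

/-- The pointwise divergence of a vector field, as the trace of its derivative. -/
noncomputable def divergence {N : ℕ}
    (F : EuclideanSpace ℝ (Fin N) → EuclideanSpace ℝ (Fin N))
    (x : EuclideanSpace ℝ (Fin N)) : ℝ :=
  LinearMap.trace ℝ (EuclideanSpace ℝ (Fin N)) (fderiv ℝ F x : _ →ₗ[ℝ] _)

theorem divergence_radial {N : ℕ} {k : ℝ → ℝ} {k' : ℝ} {x : EuclideanSpace ℝ (Fin N)}
    (hx : x ≠ 0) (hk : HasDerivAt k k' ‖x‖) :
    DifferentiableAt ℝ (fun y => k ‖y‖ • y) x ∧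
      divergence (fun y => k ‖y‖ • y) x = N * k ‖x‖ + ‖x‖ * k' := by
  have hn : DifferentiableAt ℝ (fun y : EuclideanSpace ℝ (Fin N) => ‖y‖) x :=
    (contDiffAt_norm ℝ hx).differentiableAt one_ne_zero
  have hF := (hk.comp_hasFDerivAt x hn.hasFDerivAt).smul (hasFDerivAt_id x)
  refine ⟨hF.differentiableAt, ?_⟩
  have hF' : fderiv ℝ (fun y => k ‖y‖ • y) x = _ := hF.fderiv
  rw [divergence, hF', ContinuousLinearMap.toLinearMap_add, map_add]
  have h₁ : LinearMap.trace ℝ (EuclideanSpace ℝ (Fin N))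
      (k ‖x‖ • ContinuousLinearMap.id ℝ (EuclideanSpace ℝ (Fin N)) : _ →L[ℝ] _).toLinearMap
      = N * k ‖x‖ := by
    rw [ContinuousLinearMap.toLinearMap_smul, map_smul, ContinuousLinearMap.coe_id,
      LinearMap.trace_id]
    simp [mul_comm]
  have h₂ : LinearMap.trace ℝ (EuclideanSpace ℝ (Fin N))
      ((k' • fderiv ℝ (fun y : EuclideanSpace ℝ (Fin N) => ‖y‖) x).smulRight x).toLinearMap
      = ‖x‖ * k' := by
    have := LinearMap.trace_smulRight
      (k' • fderiv ℝ (fun y : EuclideanSpace ℝ (Fin N) => ‖y‖) x).toLinearMap x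
    refine this.trans ?_
    simp [hn.fderiv_norm_self, mul_comm]
  exact congrArg₂ _ h₁ h₂

theorem gradient_gaussBump (N : ℕ) (ε μ : ℝ) (x : EuclideanSpace ℝ (Fin N)) :
    gradient (gaussBump N ε μ) x = -(2 * μ * ε * Real.exp (-μ * ‖x‖ ^ 2)) • x := by
  refine HasGradientAt.gradient ?_
  rw [hasGradientAt_iff_hasFDerivAt]
  have h := ((((hasStrictFDerivAt_norm_sq x).hasFDerivAt).const_mul (-μ)).exp).const_mul ε
  refine h.congr_fderiv ?_
  ext y
  simp
  ring

theorem lField_gaussBump {N : ℕ} {ε μ : ℝ} (hε : 0 < ε) (hμ : 0 < μ) (g : ℝ → ℝ)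
    (x : EuclideanSpace ℝ (Fin N)) :
    lField g (gaussBump N ε μ) x =
      (-(g (2 * μ * ε * Real.exp (-μ * ‖x‖ ^ 2) * ‖x‖) / ‖x‖)) • x := by
  have ha : 0 < 2 * μ * ε * Real.exp (-μ * ‖x‖ ^ 2) := by positivity
  rw [lField, gradient_gaussBump, norm_smul, norm_neg, Real.norm_of_nonneg ha.le, smul_smul]
  congr 1
  rcases eq_or_ne ‖x‖ 0 with hx | hx
  · simp [hx]
  · field_simp

theorem hasDerivAt_gaussBump_profile {g : ℝ → ℝ} {d ε μ s : ℝ} (hs : s ≠ 0)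
    (hg : HasDerivAt g d (2 * μ * ε * Real.exp (-μ * s ^ 2) * s)) :
    HasDerivAt (fun s => -(g (2 * μ * ε * Real.exp (-μ * s ^ 2) * s) / s))
      ((g (2 * μ * ε * Real.exp (-μ * s ^ 2) * s) +
        d * (2 * μ * ε * Real.exp (-μ * s ^ 2) * s) * (2 * μ * s ^ 2 - 1)) / s ^ 2) s := by
  have hφ : HasDerivAt (fun s => 2 * μ * ε * Real.exp (-μ * s ^ 2) * s)
      (2 * μ * ε * Real.exp (-μ * s ^ 2) * (1 - 2 * μ * s ^ 2)) s := by
    refine (((((hasDerivAt_pow 2 s).const_mul (-μ)).exp).const_mul (2 * μ * ε)).mul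
      (hasDerivAt_id' s)).congr_deriv ?_
    push_cast
    ring
  have hc : HasDerivAt (fun s => g (2 * μ * ε * Real.exp (-μ * s ^ 2) * s)) _ s :=
    HasDerivAt.comp s hg hφ
  refine (hc.div (hasDerivAt_id' s) hs).neg.congr_deriv ?_
  field_simp
  ring

theorem explicit_strict_subsolution_in_annulus
    (δ g₀ : ℝ) (hδ : 0 < δ) (hδg₀ : δ ≤ g₀)
    (N : ℕ) (hN : 1 ≤ N)
    (r₂ : ℝ) (hr₂ : 0 < r₂) :
    ∃ μ₀ > (0:ℝ),
      ∀ r₁ : ℝ, r₂ < r₁ →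
      ∀ (g g' : ℝ → ℝ),
        ContinuousOn g (Set.Ici 0) → g 0 = 0 →
        (∀ t > 0, 0 < g t) →
        (∀ t > 0, HasDerivAt g (g' t) t) →
        ContinuousOn g' (Set.Ioi 0) →
        (∀ t > 0, δ ≤ t * g' t / g t ∧ t * g' t / g t ≤ g₀) →
      ∀ μ : ℝ, μ₀ ≤ μ →
      ∀ ε : ℝ, 0 < ε →
      ∀ x : EuclideanSpace ℝ (Fin N), r₂ < ‖x‖ → ‖x‖ < r₁ →
        DifferentiableAt ℝ (lField g (gaussBump N ε μ)) x ∧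
        0 < divergence (lField g (gaussBump N ε μ)) x := by
  refine ⟨(1 + N / δ) / (2 * r₂ ^ 2), by positivity, ?_⟩
  intro r₁ _ g g' _ _ hpos hder _ hbd μ hμ ε hε x hx _
  have hμ0 : 0 < μ := lt_of_lt_of_le (by positivity) hμ
  have hs : 0 < ‖x‖ := hr₂.trans hx
  set t := 2 * μ * ε * Real.exp (-μ * ‖x‖ ^ 2) * ‖x‖ with ht
  have ht0 : 0 < t := by positivity
  have hfield : lField g (gaussBump N ε μ) = _ := funext (lField_gaussBump hε hμ0 g)
  obtain ⟨hdiff, hdiv⟩ := divergence_radial (norm_pos_iff.mp hs)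
    (hasDerivAt_gaussBump_profile hs.ne' (hder t ht0))
  rw [hfield]
  refine ⟨hdiff, ?_⟩
  rw [hdiv, ← ht]
  have hg := hpos t ht0
  have hδt : δ * g t ≤ g' t * t := by
    rw [mul_comm (g' t)]
    exact (le_div_iff₀ hg).mp (hbd t ht0).1
  have hμs : N / δ ≤ 2 * μ * ‖x‖ ^ 2 - 1 := by
    have h₁ := (div_le_iff₀ (by positivity)).mp hμ
    have h₂ : r₂ ^ 2 ≤ ‖x‖ ^ 2 := by gcongr
    nlinarith [mul_le_mul_of_nonneg_left h₂ hμ0.le]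
  have hmain : N * g t ≤ g' t * t * (2 * μ * ‖x‖ ^ 2 - 1) := calc
    N * g t = δ * g t * (N / δ) := by field_simp
    _ ≤ g' t * t * (2 * μ * ‖x‖ ^ 2 - 1) :=
      mul_le_mul hδt hμs (by positivity) ((by positivity : 0 ≤ δ * g t).trans hδt)
  have heq : N * -(g t / ‖x‖) + ‖x‖ * ((g t + g' t * t * (2 * μ * ‖x‖ ^ 2 - 1)) / ‖x‖ ^ 2)
      = (g t + (g' t * t * (2 * μ * ‖x‖ ^ 2 - 1) - N * g t)) / ‖x‖ := by
    field_simp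
    ring
  rw [heq]
  exact div_pos (by linarith) hs
end
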